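/- arXiv:2312.07465 — 4 statements merged into one kernel-verified Lean document; each statement's English description precedes it below -/
import Mathlib

section
/- Let Q ⊆ ℝⁿ be a nonempty closed convex set, g : ℝⁿ → ℝ a μ-weakly convex function (μ > 0), X* ⊆ Q a nonempty set with g(x*) ≤ 0 for every x* ∈ X*. Fix α > 0, γ ∈ (0,1), and a point x ∈ Q with g(x) ≥ α·dist(x, X*) and dist(x, X*) ≤ αγ/μ. Let v be a μ-weak subgradient of g at x with v ≠ 0, and set x⁺ = proj_Q(x − h·v) with h = g(x)/‖v‖₂². Then, letting x* ∈ X* be a closest point of X* to x, ‖x⁺ − x*‖₂² ≤ (1 − (1−γ)α²/‖v‖₂²)·‖x − x*‖₂²; in particular dist(x⁺, X*)² ≤ (1 − (1−γ)α²/‖v‖₂²)·dist(x, X*)². -/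
open Metric Set RealInnerProductSpace

/-- `p` is the Euclidean (metric) projection of `z` onto the set `Q`. -/
def IsProj {n : ℕ} (Q : Set (EuclideanSpace ℝ (Fin n)))
    (z p : EuclideanSpace ℝ (Fin n)) : Prop :=
  p ∈ Q ∧ ∀ y ∈ Q, ‖p - z‖ ≤ ‖y - z‖

/-- The projection onto a convex set `Q` does not increase distances to points of `Q`. -/
theorem IsProj.norm_sub_le {n : ℕ} {Q : Set (EuclideanSpace ℝ (Fin n))} (hQ : Convex ℝ Q)
    {z p y : EuclideanSpace ℝ (Fin n)} (hp : IsProj Q z p) (hy : y ∈ Q) :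
    ‖p - y‖ ≤ ‖z - y‖ := by
  have hmin : ‖z - p‖ = ⨅ w : Q, ‖z - w‖ := by
    have : Nonempty Q := ⟨⟨y, hy⟩⟩
    refine le_antisymm (le_ciInf fun w => ?_) (ciInf_le (f := fun w : Q => ‖z - w‖)
      ⟨0, by rintro _ ⟨w, rfl⟩; exact norm_nonneg _⟩ ⟨p, hp.1⟩)
    simpa only [norm_sub_rev] using hp.2 w w.2
  have hinner := (norm_eq_iInf_iff_real_inner_le_zero hQ hp.1).1 hmin y hy
  have hsq : ‖z - y‖ ^ 2 = ‖z - p‖ ^ 2 - 2 * ⟪z - p, y - p⟫ + ‖p - y‖ ^ 2 := by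
    rw [← sub_sub_sub_cancel_right z y p, norm_sub_sq_real, norm_sub_rev y p]
  exact (sq_le_sq₀ (norm_nonneg _) (norm_nonneg _)).1 (by nlinarith [sq_nonneg ‖z - p‖])

/-- per-iteration contraction on a nonproductive step for a μ-weakly
convex constraint `g`, with step `h = g x / ‖v‖²` for a μ-weak subgradient `v ≠ 0`,
assuming `g x ≥ α·dist(x, X*)` and `dist(x, X*) ≤ αγ/μ`. -/
theorem nonproductive_step_contraction_eps {n : ℕ}
    (Q Xstar : Set (EuclideanSpace ℝ (Fin n)))
    (hQne : Q.Nonempty) (hQc : IsClosed Q) (hQconv : Convex ℝ Q)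
    (g : EuclideanSpace ℝ (Fin n) → ℝ) (μ α γ : ℝ)
    (hμ : 0 < μ) (hα : 0 < α) (hγ : γ ∈ Set.Ioo (0:ℝ) 1)
    (hwconv : ConvexOn ℝ Set.univ (fun y => g y + μ / 2 * ‖y‖ ^ 2))
    (hXne : Xstar.Nonempty) (hXcl : IsClosed Xstar) (hXsub : Xstar ⊆ Q)
    (hXfeas : ∀ z ∈ Xstar, g z ≤ 0)
    (x v xplus : EuclideanSpace ℝ (Fin n)) (hxQ : x ∈ Q)
    (hsharp : g x ≥ α * Metric.infDist x Xstar)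
    (hclose : Metric.infDist x Xstar ≤ α * γ / μ)
    (hv : v ≠ 0)
    (hsub : ∀ y, g y ≥ g x + ⟪v, y - x⟫ - μ / 2 * ‖y - x‖ ^ 2)
    (hproj : IsProj Q (x - (g x / ‖v‖ ^ 2) • v) xplus) :
    (∀ xstar ∈ Xstar, ‖x - xstar‖ = Metric.infDist x Xstar →
      ‖xplus - xstar‖ ^ 2 ≤ (1 - (1 - γ) * α ^ 2 / ‖v‖ ^ 2) * ‖x - xstar‖ ^ 2) ∧
    Metric.infDist xplus Xstar ^ 2 ≤
      (1 - (1 - γ) * α ^ 2 / ‖v‖ ^ 2) * Metric.infDist x Xstar ^ 2 := by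
  have hstep : ∀ xstar ∈ Xstar, ‖x - xstar‖ = Metric.infDist x Xstar →
      ‖xplus - xstar‖ ^ 2 ≤ (1 - (1 - γ) * α ^ 2 / ‖v‖ ^ 2) * ‖x - xstar‖ ^ 2 := by
    intro xstar hxs hd
    rw [← hd] at hsharp hclose
    set d := ‖x - xstar‖
    have hd0 : 0 ≤ d := norm_nonneg _
    have hv2 : 0 < ‖v‖ ^ 2 := pow_pos (norm_pos_iff.2 hv) 2
    have hμd : μ * d ^ 2 ≤ α * γ * d := by
      rw [le_div_iff₀ hμ] at hclose
      nlinarith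
    have hg : 0 ≤ g x := (mul_nonneg hα.le hd0).trans hsharp
    have hinner : g x - μ / 2 * d ^ 2 ≤ ⟪x - xstar, v⟫ := by
      have h := hsub xstar
      rw [← neg_sub x xstar, inner_neg_right, norm_neg, real_inner_comm] at h
      linarith [hXfeas xstar hxs]
    have hgap : (1 - γ) * α ^ 2 * d ^ 2 ≤ g x * (g x - μ * d ^ 2) := by
      have h₁ : (1 - γ) * (α * d) ≤ g x - μ * d ^ 2 := by linarith
      have h₂ : 0 ≤ (1 - γ) * (α * d) :=
        mul_nonneg (by linarith [hγ.2]) (mul_nonneg hα.le hd0)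
      calc (1 - γ) * α ^ 2 * d ^ 2 = α * d * ((1 - γ) * (α * d)) := by ring
        _ ≤ g x * (g x - μ * d ^ 2) := mul_le_mul hsharp h₁ h₂ hg
    calc ‖xplus - xstar‖ ^ 2 ≤ ‖x - (g x / ‖v‖ ^ 2) • v - xstar‖ ^ 2 :=
          pow_le_pow_left₀ (norm_nonneg _) (hproj.norm_sub_le hQconv (hXsub hxs)) 2
      _ = d ^ 2 - 2 * (g x / ‖v‖ ^ 2 * ⟪x - xstar, v⟫) + (g x / ‖v‖ ^ 2 * ‖v‖) ^ 2 := by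
          rw [sub_right_comm, norm_sub_sq_real, inner_smul_right, norm_smul, Real.norm_eq_abs,
            abs_of_nonneg (div_nonneg hg hv2.le)]
      _ ≤ d ^ 2 - 2 * (g x / ‖v‖ ^ 2 * (g x - μ / 2 * d ^ 2)) + (g x / ‖v‖ ^ 2 * ‖v‖) ^ 2 := by
          gcongr
      _ = d ^ 2 - g x * (g x - μ * d ^ 2) / ‖v‖ ^ 2 := by
          field_simp
          ring
      _ ≤ d ^ 2 - (1 - γ) * α ^ 2 * d ^ 2 / ‖v‖ ^ 2 := by gcongr
      _ = (1 - (1 - γ) * α ^ 2 / ‖v‖ ^ 2) * d ^ 2 := by ring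
  refine ⟨hstep, ?_⟩
  obtain ⟨xstar, hxs, hdist⟩ := hXcl.exists_infDist_eq_dist hXne x
  rw [dist_eq_norm] at hdist
  calc Metric.infDist xplus Xstar ^ 2 ≤ ‖xplus - xstar‖ ^ 2 := by
        rw [← dist_eq_norm]
        exact pow_le_pow_left₀ Metric.infDist_nonneg (Metric.infDist_le_dist_of_mem hxs) 2
    _ ≤ _ := hdist ▸ hstep xstar hxs hdist.symm
end

section
/- Let X* ⊆ ℝⁿ be the nonempty solution set of min{f(x) : x ∈ Q, g(x) ≤ 0} with optimal value f*, and suppose the conditional sharp minimum condition max{f(x) − f*, g(x)} ≥ α·dist(x, X*) holds for all x ∈ Q with α > 0. Let C ∈ (0,1] and suppose f(x) − f̄ = c·(f(x) − f*) with c ∈ [C, 2−C]. If x ∈ Q satisfies f(x) − f̄ ≥ g(x) (productive step condition), then f(x) − f̄ ≥ min{1, c}·α·dist(x, X*). -/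
open Metric Set

/-- under the conditional sharp minimum
`max{f(x) − f*, g(x)} ≥ α·dist(x, X*)` and inexact optimal value
`f(x) − f̄ = c(f(x) − f*)`, `c ∈ [C, 2−C]`, a productive point
(`f(x) − f̄ ≥ g(x)`) satisfies `f(x) − f̄ ≥ min{1, c}·α·dist(x, X*)`. -/
theorem productive_point_lower_bound_conditional {n : ℕ}
    (Q Xstar : Set (EuclideanSpace ℝ (Fin n)))
    (f g : EuclideanSpace ℝ (Fin n) → ℝ) (fstar fbar α C c : ℝ)
    (hα : 0 < α) (hC : C ∈ Set.Ioc (0:ℝ) 1)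
    (hXne : Xstar.Nonempty)
    (hXdef : ∀ y, y ∈ Xstar ↔ y ∈ Q ∧ g y ≤ 0 ∧ ∀ z ∈ Q, g z ≤ 0 → f y ≤ f z)
    (hfstar : ∀ y ∈ Xstar, f y = fstar)
    (hsharp : ∀ y ∈ Q, max (f y - fstar) (g y) ≥ α * Metric.infDist y Xstar)
    (x : EuclideanSpace ℝ (Fin n)) (hxQ : x ∈ Q)
    (hc : c ∈ Set.Icc C (2 - C)) (hfbar : f x - fbar = c * (f x - fstar))
    (hprod : f x - fbar ≥ g x) :
    f x - fbar ≥ min 1 c * α * Metric.infDist x Xstar := by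
  have hc0 : 0 < c := hC.1.trans_le hc.1
  have hD : 0 ≤ α * Metric.infDist x Xstar := mul_nonneg hα.le Metric.infDist_nonneg
  rw [ge_iff_le, mul_assoc]
  rcases le_max_iff.mp (hsharp x hxQ) with h | h
  · calc min 1 c * (α * Metric.infDist x Xstar)
        ≤ c * (α * Metric.infDist x Xstar) := mul_le_mul_of_nonneg_right (min_le_right 1 c) hD
      _ ≤ c * (f x - fstar) := mul_le_mul_of_nonneg_left h hc0.le
      _ = f x - fbar := hfbar.symm
  · calc min 1 c * (α * Metric.infDist x Xstar)
        ≤ α * Metric.infDist x Xstar := mul_le_of_le_one_left hD (min_le_left 1 c)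
      _ ≤ g x := h
      _ ≤ f x - fbar := hprod
end

section
/- Let X* ⊆ ℝⁿ be the nonempty solution set of min{f(x) : x ∈ Q, g(x) ≤ 0} with optimal value f*, and suppose the conditional sharp minimum condition max{f(x) − f*, g(x)} ≥ α·dist(x, X*) holds for all x ∈ Q with α > 0. Let C ∈ (0,1] and suppose f(x) − f̄ = c·(f(x) − f*) with c ∈ [C, 2−C]. If x ∈ Q satisfies f(x) − f̄ < g(x) (nonproductive step condition), then g(x) ≥ C·α·dist(x, X*). -/
open Metric Set

/-- under the conditional sharp minimum
`max{f(x) − f*, g(x)} ≥ α·dist(x, X*)` and inexact optimal value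
`f(x) − f̄ = c(f(x) − f*)`, `c ∈ [C, 2−C]`, a nonproductive point
(`f(x) − f̄ < g(x)`) satisfies `g(x) ≥ C·α·dist(x, X*)`. -/
theorem nonproductive_point_lower_bound_conditional {n : ℕ}
    (Q Xstar : Set (EuclideanSpace ℝ (Fin n)))
    (f g : EuclideanSpace ℝ (Fin n) → ℝ) (fstar fbar α C c : ℝ)
    (hα : 0 < α) (hC : C ∈ Set.Ioc (0:ℝ) 1)
    (hXne : Xstar.Nonempty)
    (hXdef : ∀ y, y ∈ Xstar ↔ y ∈ Q ∧ g y ≤ 0 ∧ ∀ z ∈ Q, g z ≤ 0 → f y ≤ f z)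
    (hfstar : ∀ y ∈ Xstar, f y = fstar)
    (hsharp : ∀ y ∈ Q, max (f y - fstar) (g y) ≥ α * Metric.infDist y Xstar)
    (x : EuclideanSpace ℝ (Fin n)) (hxQ : x ∈ Q)
    (hc : c ∈ Set.Icc C (2 - C)) (hfbar : f x - fbar = c * (f x - fstar))
    (hnonprod : f x - fbar < g x) :
    g x ≥ C * α * Metric.infDist x Xstar := by
  have hd : 0 ≤ α * infDist x Xstar := mul_nonneg hα.le infDist_nonneg
  rw [ge_iff_le, mul_assoc]
  rcases le_max_iff.mp (hsharp x hxQ) with hf | hg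
  · calc C * (α * infDist x Xstar)
        ≤ c * (f x - fstar) := mul_le_mul hc.1 hf hd (hC.1.le.trans hc.1)
      _ = f x - fbar := hfbar.symm
      _ ≤ g x := hnonprod.le
  · exact (mul_le_of_le_one_left hd hC.2).trans hg
end

section
/- Let g : ℝⁿ → ℝ be μ-weakly convex (μ > 0), X* ⊆ ℝⁿ nonempty with g(x*) ≤ 0 for all x* ∈ X*, and let x ∈ ℝⁿ satisfy g(x) ≥ C·α·dist(x, X*) for constants C ∈ (0,1], α > 0, with dist(x, X*) > 0. If the zero vector is a μ-weak subgradient of g at x (i.e. g(y) ≥ g(x) − (μ/2)‖y − x‖₂² for all y), then dist(x, X*) ≥ 2Cα/μ. -/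
open Metric Set RealInnerProductSpace

/-- if the zero vector is a μ-weak subgradient of the μ-weakly convex
constraint `g` at a point `x` satisfying `g x ≥ Cα·dist(x, X*)` with
`dist(x, X*) > 0`, then `dist(x, X*) ≥ 2Cα/μ`. -/
theorem zero_subgradient_far_from_solutions {n : ℕ}
    (Xstar : Set (EuclideanSpace ℝ (Fin n)))
    (g : EuclideanSpace ℝ (Fin n) → ℝ) (μ α C : ℝ)
    (hμ : 0 < μ) (hα : 0 < α) (hC : C ∈ Set.Ioc (0:ℝ) 1)
    (hwconv : ConvexOn ℝ Set.univ (fun y => g y + μ / 2 * ‖y‖ ^ 2))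
    (hXne : Xstar.Nonempty) (hXcl : IsClosed Xstar)
    (hXfeas : ∀ z ∈ Xstar, g z ≤ 0)
    (x : EuclideanSpace ℝ (Fin n))
    (hsharp : g x ≥ C * α * Metric.infDist x Xstar)
    (hpos : 0 < Metric.infDist x Xstar)
    (hzero_sub : ∀ y, g y ≥ g x - μ / 2 * ‖y - x‖ ^ 2) :
    Metric.infDist x Xstar ≥ 2 * C * α / μ := by
  obtain ⟨z, hz, hdist⟩ := hXcl.exists_infDist_eq_dist hXne x
  have hsub := hzero_sub z
  have hfeas := hXfeas z hz
  rw [← dist_eq_norm, dist_comm, ← hdist] at hsub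
  rw [ge_iff_le, div_le_iff₀ hμ]
  refine le_of_mul_le_mul_right ?_ hpos
  linarith
end
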